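/- For every n ≥ 2, the connected sum of two copies of Sⁿ × Sⁿ satisfies TC((Sⁿ × Sⁿ) # (Sⁿ × Sⁿ)) ≤ 5. -/

import Mathlib

/-!
Common definitions: rational singular (co)homology, homotopy groups and asphericity,
classifying maps, closed oriented manifolds, connected sums, wedges, topological
complexity, sectional category weights, and (a)toroidal classes.
-/

open CategoryTheory unitInterval Topology

noncomputable section

/-- The singular chain complex with rational coefficients. -/
def singularChainComplex : TopCat.{0} ⥤ ChainComplex (ModuleCat.{0} ℚ) ℕ :=
  TopCat.toSSet ⋙ ((SimplicialObject.whiskering _ _).obj (ModuleCat.free ℚ)) ⋙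
    AlgebraicTopology.alternatingFaceMapComplex (ModuleCat ℚ)

/-- The `k`-th singular homology functor with rational coefficients. -/
def singularHomologyFunctor (k : ℕ) : TopCat.{0} ⥤ ModuleCat.{0} ℚ :=
  singularChainComplex ⋙ HomologicalComplex.homologyFunctor (ModuleCat ℚ) (ComplexShape.down ℕ) k

/-- `H k X` is the `k`-th rational singular homology group `H_k(X; ℚ)`. -/
abbrev H (k : ℕ) (X : Type) [TopologicalSpace X] : Type :=
  (singularHomologyFunctor k).obj (TopCat.of X)

/-- The map `H_k(f; ℚ)` induced on rational singular homology by a continuous map `f`. -/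
def Hmap (k : ℕ) {X Y : Type} [TopologicalSpace X] [TopologicalSpace Y] (f : C(X, Y)) :
    H k X →ₗ[ℚ] H k Y :=
  ((singularHomologyFunctor k).map (TopCat.ofHom f : TopCat.of X ⟶ TopCat.of Y)).hom

/-- `Hco k X` is the `k`-th rational singular cohomology group `H^k(X; ℚ)`; over the
field `ℚ`, universal coefficients identify it naturally with the dual of homology. -/
abbrev Hco (k : ℕ) (X : Type) [TopologicalSpace X] : Type :=
  Module.Dual ℚ (H k X)

/-- The map `H^k(f; ℚ)` induced on rational singular cohomology (the Kronecker-dual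
of the map induced on homology). -/
def Hcomap (k : ℕ) {X Y : Type} [TopologicalSpace X] [TopologicalSpace Y] (f : C(X, Y)) :
    Hco k Y →ₗ[ℚ] Hco k X :=
  (Hmap k f).dualMap

/-- Transport of a cohomology class along an equality of degrees. -/
def coCast {X : Type} [TopologicalSpace X] {p q : ℕ} (h : p = q) :
    Hco p X →ₗ[ℚ] Hco q X := by
  subst h; exact LinearMap.id

/-- A non-zero element spanning a rational vector space (necessarily one-dimensional);
this characterises fundamental classes in the top (co)homology of closed connected
oriented manifolds with rational coefficients. -/
def IsGenerator {W : Type} [AddCommGroup W] [Module ℚ W] (w : W) : Prop :=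
  w ≠ 0 ∧ ∀ v : W, ∃ c : ℚ, v = c • w

/-- `π₂(X) = 0`. -/
def Pi2Trivial (X : Type) [TopologicalSpace X] : Prop :=
  ∀ x : X, Subsingleton (HomotopyGroup (Fin 2) X x)

/-- A space is aspherical iff all its homotopy groups in degrees `≥ 2` vanish
(for manifolds this is equivalent to contractibility of the universal cover). -/
def Aspherical (X : Type) [TopologicalSpace X] : Prop :=
  ∀ k : ℕ, 2 ≤ k → ∀ x : X, Subsingleton (HomotopyGroup (Fin k) X x)

/-- A continuous map, regarded as a morphism in `TopCat`. -/
def toTopHom {X Y : Type} [TopologicalSpace X] [TopologicalSpace Y] (f : C(X, Y)) :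
    TopCat.of X ⟶ TopCat.of Y := TopCat.ofHom f

/-- The homomorphism induced by a continuous map on fundamental groups. -/
def π₁map {X Y : Type} [TopologicalSpace X] [TopologicalSpace Y] (f : C(X, Y)) (x : X) :
    Aut (FundamentalGroupoid.mk x) →* Aut (FundamentalGroupoid.mk (f x)) :=
  Functor.mapAut (X := FundamentalGroupoid.mk x)
    (show FundamentalGroupoid X ⥤ FundamentalGroupoid Y from
      FundamentalGroupoid.fundamentalGroupoidFunctor.map (toTopHom f))

/-- `B` is a model for an Eilenberg–MacLane space `K(G, 1)`:  it is path-connected and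
all its higher homotopy groups vanish. -/
def IsAsphericalSpace (B : Type) [TopologicalSpace B] : Prop :=
  PathConnectedSpace B ∧ Aspherical B

/-- `c : M → B` is a classifying map for `M`, i.e. `B` is a model for `Bπ₁(M)`
(path-connected with vanishing higher homotopy groups) and `c` induces an isomorphism
on fundamental groups. -/
def IsClassifyingMap {M B : Type} [TopologicalSpace M] [TopologicalSpace B]
    (c : C(M, B)) : Prop :=
  IsAsphericalSpace B ∧ ∀ x : M, Function.Bijective (π₁map c x)

/-- Every point has a neighbourhood homeomorphic to `ℝⁿ`. -/
def IsLocallyEuclidean (n : ℕ) (M : Type) [TopologicalSpace M] : Prop :=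
  ∀ x : M, ∃ U : Set M, x ∈ U ∧ IsOpen U ∧ Nonempty (U ≃ₜ EuclideanSpace ℝ (Fin n))

/-- A closed connected oriented topological `n`-manifold.  (For a closed connected
`n`-manifold, orientability is equivalent to `H_n(M; ℚ) ≠ 0`.) -/
def IsClosedOrientedManifold (n : ℕ) (M : Type) [TopologicalSpace M] : Prop :=
  CompactSpace M ∧ T2Space M ∧ SecondCountableTopology M ∧ ConnectedSpace M ∧
    IsLocallyEuclidean n M ∧ Nontrivial (H n M)

/-- Data exhibiting `N` as a connected sum `M₁ # M₂` of `n`-manifolds:  `N` is covered by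
two closed pieces `C₁`, `C₂`, homeomorphic to `M₁` resp. `M₂` with an embedded open ball
removed, which overlap exactly along the boundary spheres.  (Gluing along any
homeomorphism of the sphere yields a space homeomorphic to the connected sum.) -/
structure ConnectedSumData (n : ℕ) (N M₁ M₂ : Type) [TopologicalSpace N]
    [TopologicalSpace M₁] [TopologicalSpace M₂] where
  φ₁ : EuclideanSpace ℝ (Fin n) → M₁
  φ₂ : EuclideanSpace ℝ (Fin n) → M₂
  emb₁ : IsOpenEmbedding φ₁
  emb₂ : IsOpenEmbedding φ₂
  C₁ : Set N
  C₂ : Set N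
  closed₁ : IsClosed C₁
  closed₂ : IsClosed C₂
  cover : C₁ ∪ C₂ = Set.univ
  h₁ : C₁ ≃ₜ ((φ₁ '' Metric.ball 0 1)ᶜ : Set M₁)
  h₂ : C₂ ≃ₜ ((φ₂ '' Metric.ball 0 1)ᶜ : Set M₂)
  inter₁ : ∀ x : C₁, (x : N) ∈ C₂ ↔ ((h₁ x : M₁) ∈ φ₁ '' Metric.sphere 0 1)
  inter₂ : ∀ x : C₂, (x : N) ∈ C₁ ↔ ((h₂ x : M₂) ∈ φ₂ '' Metric.sphere 0 1)

/-- `N` is a connected sum of `M₁` and `M₂` (as `n`-manifolds). -/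
def IsConnectedSum (n : ℕ) (N M₁ M₂ : Type) [TopologicalSpace N]
    [TopologicalSpace M₁] [TopologicalSpace M₂] : Prop :=
  Nonempty (ConnectedSumData n N M₁ M₂)

/-- The degree-one pinch map `N = M₁ # M₂ → M₁`:  it restricts to the canonical
identification on the `M₁`-piece and sends the `M₂`-piece into the closed ball. -/
def ConnectedSumData.IsPinchFst {n : ℕ} {N M₁ M₂ : Type} [TopologicalSpace N]
    [TopologicalSpace M₁] [TopologicalSpace M₂] (D : ConnectedSumData n N M₁ M₂)
    (p : C(N, M₁)) : Prop :=
  (∀ x : D.C₁, p (x : N) = (D.h₁ x : M₁)) ∧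
    ∀ x : D.C₂, p (x : N) ∈ D.φ₁ '' Metric.closedBall 0 1

/-- The degree-one pinch map `N = M₁ # M₂ → M₂`. -/
def ConnectedSumData.IsPinchSnd {n : ℕ} {N M₁ M₂ : Type} [TopologicalSpace N]
    [TopologicalSpace M₁] [TopologicalSpace M₂] (D : ConnectedSumData n N M₁ M₂)
    (p : C(N, M₂)) : Prop :=
  (∀ x : D.C₂, p (x : N) = (D.h₂ x : M₂)) ∧
    ∀ x : D.C₁, p (x : N) ∈ D.φ₂ '' Metric.closedBall 0 1

/-- `N` is an iterated connected sum `M 0 # M 1 # ⋯ # M (m-1)` of `n`-manifolds. -/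
def IsIteratedConnectedSum (n : ℕ) (N : Type) [TopologicalSpace N] :
    (m : ℕ) → (Fin m → TopCat.{0}) → Prop
  | 0, _ => False
  | 1, M => Nonempty (N ≃ₜ (M 0))
  | (m + 2), M =>
      ∃ P : TopCat.{0}, IsIteratedConnectedSum n P (m + 1) (fun i => M i.castSucc) ∧
        IsConnectedSum n N P (M (Fin.last (m + 1)))

/-- `W` is the wedge (one-point union) of the pointed spaces `(M₁, x₁)` and `(M₂, x₂)`. -/
def IsWedge (W M₁ M₂ : Type) [TopologicalSpace W] [TopologicalSpace M₁]
    [TopologicalSpace M₂] (x₁ : M₁) (x₂ : M₂) : Prop :=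
  ∃ (j₁ : C(M₁, W)) (j₂ : C(M₂, W)), IsClosedEmbedding j₁ ∧ IsClosedEmbedding j₂ ∧
    Set.range j₁ ∪ Set.range j₂ = Set.univ ∧
    Set.range j₁ ∩ Set.range j₂ = {j₁ x₁} ∧ j₁ x₁ = j₂ x₂

/-- `X × X` admits a cover by `m` open sets over each of which there is a continuous
motion planning rule (a continuous local section of the free path fibration). -/
def TCCoverable (X : Type) [TopologicalSpace X] (m : ℕ) : Prop :=
  ∃ U : Fin m → Set (X × X), (∀ i, IsOpen (U i)) ∧ (⋃ i, U i) = Set.univ ∧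
    ∀ i, ∃ s : C(U i, C(I, X)),
      ∀ p : U i, (s p) 0 = (p : X × X).1 ∧ (s p) 1 = (p : X × X).2

/-- The (unreduced) topological complexity of `X`:  the smallest number of open sets in a
cover of `X × X` admitting continuous motion planning rules (`⊤` if there is none). -/
def topologicalComplexity (X : Type) [TopologicalSpace X] : ℕ∞ :=
  sInf {c : ℕ∞ | ∃ m : ℕ, c = m ∧ TCCoverable X m}

/-- The free path fibration `X^{[0,1]} → X × X`, `γ ↦ (γ(0), γ(1))`. -/
def pathFibration (X : Type) [TopologicalSpace X] : C(C(I, X), X × X) :=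
  ⟨fun γ => (γ 0, γ 1), (continuous_eval_const 0).prodMk (continuous_eval_const 1)⟩

/-- The Schwarz genus (sectional category) of the pullback of `p` along `f` is at most
`k`:  `Y` is covered by `k` open sets over each of which `f` lifts continuously
through `p`. -/
def GenusPullbackLE {E B : Type} [TopologicalSpace E] [TopologicalSpace B] (p : C(E, B))
    {Y : Type} [TopologicalSpace Y] (f : C(Y, B)) (k : ℕ) : Prop :=
  ∃ U : Fin k → Set Y, (∀ i, IsOpen (U i)) ∧ (⋃ i, U i) = Set.univ ∧
    ∀ i, ∃ s : C(U i, E), ∀ y : U i, p (s y) = f (y : Y)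

/-- The sectional category weight of a cohomology class `u` on the base of `p`:  the
supremum of those `m` such that `u` pulls back to zero along every map `f` for which
the pullback of `p` along `f` has Schwarz genus at most `m`. -/
def secatWeight {E B : Type} [TopologicalSpace E] [TopologicalSpace B] (p : C(E, B))
    {k : ℕ} (u : Hco k B) : ℕ∞ :=
  sSup {w : ℕ∞ | ∃ m : ℕ, w = m ∧ ∀ (Y : Type) [TopologicalSpace Y] (f : C(Y, B)),
    GenusPullbackLE p f m → Hcomap k f u = 0}

/-- The topological complexity weight:  sectional category weight with respect to the
free path fibration. -/
def tcWeight {X : Type} [TopologicalSpace X] {k : ℕ} (u : Hco k (X × X)) : ℕ∞ :=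
  secatWeight (pathFibration X) u

/-- The `n`-dimensional sphere. -/
abbrev unitSphere (n : ℕ) : Type :=
  ↥(Metric.sphere (0 : EuclideanSpace ℝ (Fin (n + 1))) 1)

/-- The 2-torus `T² = S¹ × S¹`. -/
abbrev Torus2 : Type := unitSphere 1 × unitSphere 1

/-- A degree-two rational homology class `v` is toroidal (relative to a fundamental class
`ωT` of the torus) if some map from the torus realises a non-zero multiple of `v`. -/
def IsToroidal {X : Type} [TopologicalSpace X] (ωT : H 2 Torus2) (v : H 2 X) : Prop :=
  ∃ (f : C(Torus2, X)) (α : ℚ), α ≠ 0 ∧ Hmap 2 f ωT = α • v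

/-- A non-zero degree-two rational homology class is atoroidal if it is not toroidal. -/
def IsAtoroidal {X : Type} [TopologicalSpace X] (ωT : H 2 Torus2) (v : H 2 X) : Prop :=
  v ≠ 0 ∧ ¬ IsToroidal ωT v

/-- A degree-two rational cohomology class `u` is toroidal if it pulls back non-trivially
under some map from the torus. -/
def IsCoToroidal {X : Type} [TopologicalSpace X] (u : Hco 2 X) : Prop :=
  ∃ f : C(Torus2, X), Hcomap 2 f u ≠ 0

/-- A non-zero degree-two rational cohomology class is atoroidal if it pulls back to zero
under every map from the torus. -/
def IsCoAtoroidal {X : Type} [TopologicalSpace X] (u : Hco 2 X) : Prop :=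
  u ≠ 0 ∧ ∀ f : C(Torus2, X), Hcomap 2 f u = 0


/-! ### Families of paths and motion planners -/

section PathFamilies

variable {X Y Z : Type*} [TopologicalSpace X] [TopologicalSpace Y] [TopologicalSpace Z]

/-- Concatenation of two continuous families of paths. -/
lemma exists_continuousOn_concat {U : Set Y} {s t : Y → C(I, X)}
    (hs : ContinuousOn s U) (ht : ContinuousOn t U) (hst : ∀ y ∈ U, s y 1 = t y 0) :
    ∃ r : Y → C(I, X), ContinuousOn r U ∧ ∀ y ∈ U, r y 0 = s y 0 ∧ r y 1 = t y 1 := by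
  classical
  let γ : ∀ y : U, Path (s y 0) (s y 1) := fun y => ⟨s y, rfl, rfl⟩
  let δ : ∀ y : U, Path (s y 1) (t y 1) := fun y => ⟨t y, (hst y y.2).symm, rfl⟩
  have hγ : Continuous ↿γ := by
    have h : Continuous fun p : U × I => s p.1 p.2 :=
      ContinuousEval.continuous_eval.comp
        ((hs.domRestrict.comp continuous_fst).prodMk continuous_snd)
    exact h
  have hδ : Continuous ↿δ := by
    have h : Continuous fun p : U × I => t p.1 p.2 :=
      ContinuousEval.continuous_eval.comp
        ((ht.domRestrict.comp continuous_fst).prodMk continuous_snd)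
    exact h
  let F : C(U × I, X) := ⟨_, Path.trans_continuous_family γ hγ δ hδ⟩
  refine ⟨fun y => if h : y ∈ U then F.curry ⟨y, h⟩ else s y, ?_, fun y hy => ?_⟩
  · rw [continuousOn_iff_continuous_domRestrict]
    convert F.curry.continuous using 1
    ext y : 1
    simp
  · simp only [hy, dif_pos]
    exact ⟨((γ ⟨y, hy⟩).trans (δ ⟨y, hy⟩)).source, ((γ ⟨y, hy⟩).trans (δ ⟨y, hy⟩)).target⟩

/-- Sections given on the members of a disjoint family of open sets glue. -/
lemma exists_continuousOn_iUnion {ι : Type*} [Nonempty Z] {U : ι → Set Y}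
    (hU : ∀ i, IsOpen (U i)) (hd : ∀ i j y, y ∈ U i → y ∈ U j → i = j) {R : Y → Z → Prop}
    (h : ∀ i, ∃ s : Y → Z, ContinuousOn s (U i) ∧ ∀ y ∈ U i, R y (s y)) :
    ∃ s : Y → Z, ContinuousOn s (⋃ i, U i) ∧ ∀ y ∈ ⋃ i, U i, R y (s y) := by
  classical
  choose s hs hR using h
  let r : Y → Z := fun y =>
    if hy : ∃ i, y ∈ U i then s hy.choose y else Classical.arbitrary Z
  have hr : ∀ i, ∀ y ∈ U i, r y = s i y := fun i y hy => by
    have hex : ∃ i, y ∈ U i := ⟨i, hy⟩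
    simp only [r, hex, dif_pos]
    rw [hd _ _ y hex.choose_spec hy]
  refine ⟨r, ContinuousOn.iUnion_of_isOpen (fun i => (hs i).congr (hr i)) hU, fun y hy => ?_⟩
  obtain ⟨i, hi⟩ := Set.mem_iUnion.1 hy
  rw [hr i y hi]
  exact hR i y hi

/-- The set `U` can be deformed in `X` to any prescribed point. -/
def IsNullIn (U : Set X) : Prop :=
  ∀ x₀ : X, ∃ s : X → C(I, X), ContinuousOn s U ∧ ∀ x ∈ U, s x 0 = x ∧ s x 1 = x₀

lemma IsNullIn.mono {U V : Set X} (hV : IsNullIn V) (h : U ⊆ V) : IsNullIn U := fun x₀ => by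
  obtain ⟨s, hs, hs'⟩ := hV x₀
  exact ⟨s, hs.mono h, fun x hx => hs' x (h hx)⟩

lemma IsNullIn.iUnion {ι : Type*} {U : ι → Set X} (hU : ∀ i, IsOpen (U i))
    (hd : ∀ i j x, x ∈ U i → x ∈ U j → i = j) (h : ∀ i, IsNullIn (U i)) :
    IsNullIn (⋃ i, U i) := fun x₀ =>
  have : Nonempty C(I, X) := ⟨.const _ x₀⟩
  exists_continuousOn_iUnion (Z := C(I, X)) (R := fun x γ => γ 0 = x ∧ γ 1 = x₀) hU hd
    fun i => h i x₀

lemma IsNullIn.union {U V : Set X} (hU : IsOpen U) (hV : IsOpen V) (hd : Disjoint U V)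
    (hU' : IsNullIn U) (hV' : IsNullIn V) : IsNullIn (U ∪ V) := by
  rw [Set.union_eq_iUnion]
  refine IsNullIn.iUnion (by simp [hU, hV]) ?_ (by simp [hU', hV'])
  rw [Set.disjoint_left] at hd
  rintro (_ | _) (_ | _) x h h' <;> simp_all

lemma isNullIn_of_contraction [PathConnectedSpace X] {f : Z → X} (hf : IsEmbedding f)
    {T : Set Z} {c : Z} {k : Z → C(I, Z)} (hk : ContinuousOn k T)
    (hk' : ∀ z ∈ T, k z 0 = z ∧ k z 1 = c) : IsNullIn (f '' T) := fun x₀ => by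
  have : Nonempty Z := ⟨c⟩
  let g : X → Z := Function.invFun f
  have hgf : ∀ z, g (f z) = z := Function.leftInverse_invFun hf.injective
  have hg : ContinuousOn g (f '' T) := by
    rw [hf.isInducing.continuousOn_iff]
    refine continuousOn_id.congr ?_
    rintro _ ⟨z, -, rfl⟩
    simp [hgf]
  have hmaps : Set.MapsTo g (f '' T) T := by
    rintro _ ⟨z, hz, rfl⟩
    rwa [hgf]
  obtain ⟨r, hr, hr'⟩ := exists_continuousOn_concat (U := f '' T)
    (s := fun x => (ContinuousMap.mk f hf.continuous).comp (k (g x)))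
    (t := fun _ => (PathConnectedSpace.somePath (f c) x₀ : C(I, X)))
    ((ContinuousMap.continuous_postcomp _).comp_continuousOn (hk.comp hg hmaps))
    continuousOn_const (by
      rintro _ ⟨z, hz, rfl⟩
      simp [hgf, hk' z hz])
  refine ⟨r, hr, fun x hx => ?_⟩
  rw [(hr' x hx).1, (hr' x hx).2]
  obtain ⟨z, hz, rfl⟩ := hx
  simp [hgf, hk' z hz]

lemma IsNullIn.image [PathConnectedSpace X] [Nonempty Z] {f : Z → X} (hf : IsEmbedding f)
    {T : Set Z} (hT : IsNullIn T) : IsNullIn (f '' T) := by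
  obtain ⟨k, hk, hk'⟩ := hT (Classical.arbitrary Z)
  exact isNullIn_of_contraction hf hk hk'

lemma isNullIn_range [PathConnectedSpace X] [ContractibleSpace Z] {f : Z → X}
    (hf : IsEmbedding f) : IsNullIn (Set.range f) := by
  obtain ⟨c, ⟨K⟩⟩ := id_nullhomotopic Z
  rw [← Set.image_univ]
  refine isNullIn_of_contraction hf (c := c)
    (k := fun z => ⟨fun t => K (t, z), by fun_prop⟩) ?_ (by simp)
  refine Continuous.continuousOn (ContinuousMap.continuous_of_continuous_uncurry _ ?_)
  exact K.continuous.comp continuous_swap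

/-- The motion planner on a product of two deformable sets. -/
lemma IsNullIn.exists_motionPlanner {U V : Set X} (hU : IsNullIn U) (hV : IsNullIn V)
    {W : Set (X × X)} (hW : W ⊆ U ×ˢ V) :
    ∃ s : X × X → C(I, X), ContinuousOn s W ∧ ∀ p ∈ W, s p 0 = p.1 ∧ s p 1 = p.2 := by
  rcases isEmpty_or_nonempty X with hX | ⟨⟨x₀⟩⟩
  · exact ⟨fun p => isEmptyElim p.1, fun p => isEmptyElim p.1, fun p => isEmptyElim p.1⟩
  obtain ⟨s, hs, hs'⟩ := hU x₀
  obtain ⟨t, ht, ht'⟩ := hV x₀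
  obtain ⟨r, hr, hr'⟩ := exists_continuousOn_concat (U := W) (s := fun p => s p.1)
    (t := fun p => (t p.2).comp ⟨σ, unitInterval.continuous_symm⟩)
    (hs.comp continuousOn_fst fun p hp => (hW hp).1)
    ((ContinuousMap.continuous_precomp _).comp_continuousOn
      (ht.comp continuousOn_snd fun p hp => (hW hp).2))
    (fun p hp => by simp [hs' _ (hW hp).1, ht' _ (hW hp).2])
  refine ⟨r, hr, fun p hp => ?_⟩
  rw [(hr' p hp).1, (hr' p hp).2]
  simp [hs' _ (hW hp).1, ht' _ (hW hp).2]

end PathFamilies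

/-- A normal space covered by `m + 1` open sets deformable to a point admits `2 m + 1` motion
planners. -/
lemma tcCoverable_of_isNullIn {X : Type} [TopologicalSpace X] [NormalSpace X] [Nonempty X]
    {m : ℕ} {U : Fin (m + 1) → Set X} (hU : ∀ i, IsOpen (U i)) (hcov : ⋃ i, U i = Set.univ)
    (hnull : ∀ i, IsNullIn (U i)) : TCCoverable X (2 * m + 1) := by
  obtain ⟨f, hf⟩ := PartitionOfUnity.exists_isSubordinate_of_locallyFinite isClosed_univ U hU
    (locallyFinite_of_finite U) hcov.ge
  have hfU : ∀ i x, 0 < f i x → x ∈ U i := fun i x hx =>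
    hf i (subset_tsupport _ hx.ne')
  let W : Fin (m + 1) × Fin (m + 1) → Set (X × X) := fun a => {p |
    (0 < f a.1 p.1 ∧ 0 < f a.2 p.2) ∧ (∀ l < a.1, f l p.1 < f a.2 p.2) ∧
      ∀ l < a.2, f l p.2 < f a.1 p.1}
  have hWo : ∀ a, IsOpen (W a) := fun a => by
    have h₁ : ∀ l, Continuous fun p : X × X => f l p.1 := fun l =>
      (f l).continuous.comp continuous_fst
    have h₂ : ∀ l, Continuous fun p : X × X => f l p.2 := fun l =>
      (f l).continuous.comp continuous_snd
    simp only [W, Set.ofPred_and, Set.ofPred_forall]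
    refine ((isOpen_lt continuous_const (h₁ _)).inter (isOpen_lt continuous_const (h₂ _))).inter
      (.inter ?_ ?_)
    · exact isOpen_iInter_of_finite fun l => isOpen_iInter_of_finite fun _ =>
        isOpen_lt (h₁ _) (h₂ _)
    · exact isOpen_iInter_of_finite fun l => isOpen_iInter_of_finite fun _ =>
        isOpen_lt (h₂ _) (h₁ _)
  have hWU : ∀ a, W a ⊆ U a.1 ×ˢ U a.2 := fun a p hp =>
    ⟨hfU _ _ hp.1.1, hfU _ _ hp.1.2⟩
  have hle : ∀ a b p, p ∈ W a → p ∈ W b → (a.1 : ℕ) + a.2 = b.1 + b.2 → b.1 ≤ a.1 := by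
    intro a b p ha hb hab
    by_contra! hlt
    have h₂ : b.2 < a.2 := by
      rw [Fin.lt_def] at hlt ⊢
      omega
    exact lt_asymm (ha.2.2 _ h₂) (hb.2.1 _ hlt)
  have hmin : ∀ x, ∃ i, 0 < f i x ∧ ∀ l < i, f l x = 0 := fun x => by
    classical
    obtain ⟨i, hi, hi'⟩ := exists_minimal_of_wellFoundedLT (fun i => 0 < f i x)
      (f.exists_pos (Set.mem_univ x))
    exact ⟨i, hi, fun l hl => ((f.nonneg l x).eq_of_not_lt
      fun h => absurd (hi' h hl.le) hl.not_ge).symm⟩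
  let J : Fin (2 * m + 1) → Type := fun k => {a : Fin (m + 1) × Fin (m + 1) // (a.1 : ℕ) + a.2 = k}
  have : Nonempty C(I, X) := ⟨.const _ (Classical.arbitrary X)⟩
  refine ⟨fun k => ⋃ a : J k, W a.1, fun k => isOpen_iUnion fun a => hWo _, ?_, fun k => ?_⟩
  · refine Set.eq_univ_of_forall fun p => ?_
    obtain ⟨i, hi, hi'⟩ := hmin p.1
    obtain ⟨j, hj, hj'⟩ := hmin p.2
    refine Set.mem_iUnion.2 ⟨⟨i + j, by omega⟩, Set.mem_iUnion.2 ⟨⟨(i, j), rfl⟩, ⟨hi, hj⟩, ?_, ?_⟩⟩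
    · intro l hl
      simpa [hi' l hl] using hj
    · intro l hl
      simpa [hj' l hl] using hi
  · obtain ⟨s, hs, hs'⟩ := exists_continuousOn_iUnion (Z := C(I, X))
      (U := fun a : J k => W a.1) (fun a => hWo _) (fun a b p ha hb => by
        have h₁ := hle _ _ p ha hb (a.2.trans b.2.symm)
        have h₂ := hle _ _ p hb ha (b.2.trans a.2.symm)
        have h₃ := a.2
        have h₄ := b.2
        rw [Fin.le_def] at h₁ h₂
        refine Subtype.ext (Prod.ext ?_ ?_) <;> rw [Fin.ext_iff] <;> omega)
      (R := fun p γ => γ 0 = p.1 ∧ γ 1 = p.2)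
      (fun a => (hnull _).exists_motionPlanner (hnull _) (hWU a.1))
    exact ⟨⟨_, hs.domRestrict⟩, fun p => hs' p p.2⟩

/-! ### The two punctured summands as open subsets of a connected sum -/

/-- A map is an embedding if it is one on each of two closed pieces of the source which are cut
out by closed subsets of the target. -/
lemma isEmbedding_of_closed_cover {X Y A B : Type*} [TopologicalSpace X] [TopologicalSpace Y]
    [TopologicalSpace A] [TopologicalSpace B] {f : X → Y} {a : A → X} {b : B → X}
    (ha : IsClosedEmbedding a) (hb : IsClosedEmbedding b)
    (hab : ∀ x, x ∈ Set.range a ∨ x ∈ Set.range b)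
    (hfa : IsEmbedding (f ∘ a)) (hfb : IsEmbedding (f ∘ b)) {C D : Set Y}
    (hC : IsClosed C) (hD : IsClosed D) (hfC : ∀ x, f x ∈ C ↔ x ∈ Set.range a)
    (hfD : ∀ x, f x ∈ D ↔ x ∈ Set.range b) : IsEmbedding f := by
  refine ⟨⟨TopologicalSpace.ext_isClosed fun K => ?_⟩, fun x y hxy => ?_⟩
  · rw [isClosed_induced_iff]
    constructor
    · intro hK
      obtain ⟨K₁, hK₁, h₁⟩ := hfa.isInducing.isClosed_iff.1 (hK.preimage ha.continuous)
      obtain ⟨K₂, hK₂, h₂⟩ := hfb.isInducing.isClosed_iff.1 (hK.preimage hb.continuous)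
      rw [Set.ext_iff] at h₁ h₂
      refine ⟨K₁ ∩ C ∪ K₂ ∩ D, (hK₁.inter hC).union (hK₂.inter hD), Set.ext fun x => ?_⟩
      simp only [Set.mem_preimage, Set.mem_union, Set.mem_inter_iff, hfC, hfD]
      constructor
      · rintro (⟨h, ⟨y, rfl⟩⟩ | ⟨h, ⟨y, rfl⟩⟩)
        · exact (h₁ y).1 h
        · exact (h₂ y).1 h
      · intro hx
        rcases hab x with ⟨y, rfl⟩ | ⟨y, rfl⟩
        · exact .inl ⟨(h₁ y).2 hx, y, rfl⟩
        · exact .inr ⟨(h₂ y).2 hx, y, rfl⟩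
    · rintro ⟨L, hL, rfl⟩
      have : f ⁻¹' L = a '' ((f ∘ a) ⁻¹' L) ∪ b '' ((f ∘ b) ⁻¹' L) := by
        ext x
        constructor
        · intro hx
          rcases hab x with ⟨y, rfl⟩ | ⟨y, rfl⟩
          · exact .inl ⟨y, hx, rfl⟩
          · exact .inr ⟨y, hx, rfl⟩
        · rintro (⟨y, hy, rfl⟩ | ⟨y, hy, rfl⟩) <;> exact hy
      rw [this]
      exact (ha.isClosedMap _ (hL.preimage hfa.continuous)).union
        (hb.isClosedMap _ (hL.preimage hfb.continuous))
  · rcases hab x with hx | hx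
    · obtain ⟨z, rfl⟩ := (hfC y).1 (hxy ▸ (hfC x).2 hx)
      obtain ⟨w, rfl⟩ := hx
      rw [hfa.injective hxy]
    · obtain ⟨z, rfl⟩ := (hfD y).1 (hxy ▸ (hfD x).2 hx)
      obtain ⟨w, rfl⟩ := hx
      rw [hfb.injective hxy]

lemma ne_zero_of_one_le_norm {E : Type*} [NormedAddCommGroup E] {x : E} (h : 1 ≤ ‖x‖) :
    x ≠ 0 :=
  norm_pos_iff.1 (one_pos.trans_le h)

section Inversion

variable {E : Type*} [NormedAddCommGroup E] [NormedSpace ℝ E]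

/-- The radial projection of a nonzero vector to the unit sphere. -/
def radialProj (x : E) (hx : x ≠ 0) : Metric.sphere (0 : E) 1 :=
  ⟨‖x‖⁻¹ • x, by simp [norm_smul, hx]⟩

/-- The inversion in the unit sphere, twisted by a self-map of the sphere. -/
def twistedInversion (g : Metric.sphere (0 : E) 1 → Metric.sphere (0 : E) 1) (x : E)
    (hx : x ≠ 0) : E :=
  ‖x‖⁻¹ • (g (radialProj x hx) : E)

lemma norm_twistedInversion (g : Metric.sphere (0 : E) 1 → Metric.sphere (0 : E) 1) (x : E)
    (hx : x ≠ 0) : ‖twistedInversion g x hx‖ = ‖x‖⁻¹ := by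
  simp [twistedInversion, norm_smul]

lemma twistedInversion_ne_zero (g : Metric.sphere (0 : E) 1 → Metric.sphere (0 : E) 1) (x : E)
    (hx : x ≠ 0) : twistedInversion g x hx ≠ 0 := by
  rw [← norm_ne_zero_iff, norm_twistedInversion]
  simpa using hx

lemma radialProj_twistedInversion (g : Metric.sphere (0 : E) 1 → Metric.sphere (0 : E) 1) (x : E)
    (hx : x ≠ 0) :
    radialProj _ (twistedInversion_ne_zero g x hx) = g (radialProj x hx) := by
  ext1
  have : ‖x‖ ≠ 0 := norm_ne_zero_iff.2 hx
  simp only [radialProj, norm_twistedInversion]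
  simp only [twistedInversion, inv_inv, smul_smul]
  simp [this, radialProj]

lemma twistedInversion_twistedInversion
    {g g' : Metric.sphere (0 : E) 1 → Metric.sphere (0 : E) 1} (hg : Function.LeftInverse g' g)
    (x : E) (hx : x ≠ 0) :
    twistedInversion g' _ (twistedInversion_ne_zero g x hx) = x := by
  have : ‖x‖ ≠ 0 := norm_ne_zero_iff.2 hx
  rw [twistedInversion, radialProj_twistedInversion, hg, norm_twistedInversion]
  simp [radialProj, smul_smul, this]

lemma twistedInversion_of_norm_eq_one (g : Metric.sphere (0 : E) 1 → Metric.sphere (0 : E) 1)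
    (u : Metric.sphere (0 : E) 1) (hu : (u : E) ≠ 0) : twistedInversion g u hu = g u := by
  have : radialProj (u : E) hu = u := by
    ext1
    simp [radialProj]
  simp [twistedInversion, this]

lemma continuous_twistedInversion {g : Metric.sphere (0 : E) 1 → Metric.sphere (0 : E) 1}
    (hg : Continuous g) {S : Type*} [TopologicalSpace S] {v : S → E} (hv : Continuous v)
    (h0 : ∀ s, v s ≠ 0) : Continuous fun s => twistedInversion g (v s) (h0 s) := by
  have h : Continuous fun s => ‖v s‖⁻¹ := hv.norm.inv₀ fun s => norm_ne_zero_iff.2 (h0 s)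
  exact h.smul (continuous_subtype_val.comp (hg.comp ((h.smul hv).subtype_mk _)))

lemma one_le_norm_twistedInversion (g : Metric.sphere (0 : E) 1 → Metric.sphere (0 : E) 1) (x : E)
    (hx : x ≠ 0) (h : ‖x‖ ≤ 1) : 1 ≤ ‖twistedInversion g x hx‖ := by
  rw [norm_twistedInversion]
  exact (one_le_inv₀ (norm_pos_iff.2 hx)).2 h

lemma norm_twistedInversion_le_one (g : Metric.sphere (0 : E) 1 → Metric.sphere (0 : E) 1) (x : E)
    (hx : x ≠ 0) (h : 1 ≤ ‖x‖) : ‖twistedInversion g x hx‖ ≤ 1 := by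
  rw [norm_twistedInversion]
  exact inv_le_one_of_one_le₀ h

/-- The twisted inversion exchanges the punctured unit ball and the exterior of the ball. -/
def twistedInversionHomeomorph (g : Metric.sphere (0 : E) 1 ≃ₜ Metric.sphere (0 : E) 1) :
    {x : E // x ≠ 0 ∧ ‖x‖ ≤ 1} ≃ₜ {y : E // 1 ≤ ‖y‖} where
  toFun x := ⟨twistedInversion g x.1 x.2.1, one_le_norm_twistedInversion g x.1 x.2.1 x.2.2⟩
  invFun y := ⟨twistedInversion g.symm y.1 (ne_zero_of_one_le_norm y.2),
    twistedInversion_ne_zero g.symm y.1 (ne_zero_of_one_le_norm y.2),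
    norm_twistedInversion_le_one g.symm y.1 (ne_zero_of_one_le_norm y.2) y.2⟩
  left_inv x := Subtype.ext (twistedInversion_twistedInversion g.left_inv x.1 x.2.1)
  right_inv y := Subtype.ext
    (twistedInversion_twistedInversion g.right_inv y.1 (ne_zero_of_one_le_norm y.2))
  continuous_toFun :=
    (continuous_twistedInversion g.continuous continuous_subtype_val fun x => x.2.1).subtype_mk _
  continuous_invFun :=
    (continuous_twistedInversion g.symm.continuous continuous_subtype_val fun y =>
      ne_zero_of_one_le_norm y.2).subtype_mk _

lemma norm_twistedInversionHomeomorph (g : Metric.sphere (0 : E) 1 ≃ₜ Metric.sphere (0 : E) 1)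
    (x : {x : E // x ≠ 0 ∧ ‖x‖ ≤ 1}) : ‖(twistedInversionHomeomorph g x).1‖ = ‖x.1‖⁻¹ :=
  norm_twistedInversion g x.1 x.2.1

end Inversion

namespace ConnectedSumData

variable {n : ℕ} {N M₁ M₂ : Type} [TopologicalSpace N] [TopologicalSpace M₁]
  [TopologicalSpace M₂]

/-- Interchanging the two summands. -/
def symm (D : ConnectedSumData n N M₁ M₂) : ConnectedSumData n N M₂ M₁ where
  φ₁ := D.φ₂
  φ₂ := D.φ₁
  emb₁ := D.emb₂
  emb₂ := D.emb₁
  C₁ := D.C₂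
  C₂ := D.C₁
  closed₁ := D.closed₂
  closed₂ := D.closed₁
  cover := by rw [Set.union_comm, D.cover]
  h₁ := D.h₂
  h₂ := D.h₁
  inter₁ := D.inter₂
  inter₂ := D.inter₁

lemma mem_or_mem (D : ConnectedSumData n N M₁ M₂) (x : N) : x ∈ D.C₁ ∨ x ∈ D.C₂ := by
  simpa [← D.cover] using Set.mem_univ x

lemma φ₁_notMem (D : ConnectedSumData n N M₁ M₂) {y : EuclideanSpace ℝ (Fin n)}
    (hy : 1 ≤ ‖y‖) : D.φ₁ y ∈ (D.φ₁ '' Metric.ball 0 1)ᶜ := by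
  rintro ⟨z, hz, h⟩
  rw [D.emb₁.injective h] at hz
  simp at hz
  linarith

/-- The open collar of the boundary sphere of the first piece, as the exterior of a ball. -/
def collar (D : ConnectedSumData n N M₁ M₂) (y : {y : EuclideanSpace ℝ (Fin n) // 1 ≤ ‖y‖}) : N :=
  D.h₁.symm ⟨D.φ₁ y, D.φ₁_notMem y.2⟩

lemma collar_mem (D : ConnectedSumData n N M₁ M₂)
    (y : {y : EuclideanSpace ℝ (Fin n) // 1 ≤ ‖y‖}) : D.collar y ∈ D.C₁ :=
  Subtype.coe_prop _

lemma h₁_collar (D : ConnectedSumData n N M₁ M₂)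
    (y : {y : EuclideanSpace ℝ (Fin n) // 1 ≤ ‖y‖}) :
    (D.h₁ ⟨D.collar y, D.collar_mem y⟩ : M₁) = D.φ₁ y := by
  simp [collar]

lemma collar_mem_iff (D : ConnectedSumData n N M₁ M₂)
    (y : {y : EuclideanSpace ℝ (Fin n) // 1 ≤ ‖y‖}) : D.collar y ∈ D.C₂ ↔ ‖y.1‖ = 1 := by
  have := D.inter₁ ⟨D.collar y, D.collar_mem y⟩
  rw [h₁_collar, D.emb₁.injective.mem_set_image] at this
  simpa using this

lemma exists_collar_eq (D : ConnectedSumData n N M₁ M₂) {x : N} (hx : x ∈ D.C₁)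
    {y : EuclideanSpace ℝ (Fin n)} (hxy : (D.h₁ ⟨x, hx⟩ : M₁) = D.φ₁ y) :
    ∃ hy : 1 ≤ ‖y‖, D.collar ⟨y, hy⟩ = x := by
  have hy : 1 ≤ ‖y‖ := by
    by_contra! h
    exact (D.h₁ ⟨x, hx⟩).2 ⟨y, by simpa using h, hxy.symm⟩
  refine ⟨hy, ?_⟩
  rw [collar, show (⟨D.φ₁ y, D.φ₁_notMem hy⟩ : ((D.φ₁ '' Metric.ball 0 1)ᶜ : Set M₁)) =
    D.h₁ ⟨x, hx⟩ from Subtype.ext hxy.symm]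
  simp

lemma isEmbedding_collar (D : ConnectedSumData n N M₁ M₂) : IsEmbedding D.collar :=
  IsEmbedding.subtypeVal.comp (D.h₁.symm.isEmbedding.comp
    ((D.emb₁.isEmbedding.comp IsEmbedding.subtypeVal).codRestrict _ _))

/-- The identification of the boundary sphere of the first piece with `C₁ ∩ C₂`. -/
def boundary (D : ConnectedSumData n N M₁ M₂)
    (u : Metric.sphere (0 : EuclideanSpace ℝ (Fin n)) 1) : N :=
  D.collar ⟨u, by simp⟩

lemma isEmbedding_boundary (D : ConnectedSumData n N M₁ M₂) : IsEmbedding D.boundary :=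
  D.isEmbedding_collar.comp (IsEmbedding.subtypeVal.codRestrict {y | 1 ≤ ‖y‖} _)

lemma range_boundary (D : ConnectedSumData n N M₁ M₂) :
    Set.range D.boundary = D.C₁ ∩ D.C₂ := by
  ext x
  constructor
  · rintro ⟨u, rfl⟩
    exact ⟨D.collar_mem _, (D.collar_mem_iff _).2 (by simp)⟩
  · rintro ⟨h₁, h₂⟩
    obtain ⟨y, hy, hxy⟩ := (D.inter₁ ⟨x, h₁⟩).1 h₂
    obtain ⟨hy', rfl⟩ := D.exists_collar_eq h₁ hxy.symm
    exact ⟨⟨y, hy⟩, rfl⟩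

/-- The gluing homeomorphism between the two boundary spheres. -/
def gluing (D : ConnectedSumData n N M₁ M₂) :
    Metric.sphere (0 : EuclideanSpace ℝ (Fin n)) 1 ≃ₜ
      Metric.sphere (0 : EuclideanSpace ℝ (Fin n)) 1 :=
  (D.isEmbedding_boundary.toHomeomorph.trans (Homeomorph.setCongr (by
    rw [D.range_boundary, D.symm.range_boundary, Set.inter_comm]
    rfl))).trans D.symm.isEmbedding_boundary.toHomeomorph.symm

lemma boundary_gluing (D : ConnectedSumData n N M₁ M₂)
    (u : Metric.sphere (0 : EuclideanSpace ℝ (Fin n)) 1) :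
    D.symm.boundary (D.gluing u) = D.boundary u := by
  have h := D.symm.isEmbedding_boundary.toHomeomorph.apply_symm_apply
    ((Homeomorph.setCongr (by
      rw [D.range_boundary, D.symm.range_boundary, Set.inter_comm]
      rfl)) (D.isEmbedding_boundary.toHomeomorph u))
  exact congrArg Subtype.val h

/-- The first summand, punctured at the centre of the removed ball, is an open subset of the
connected sum. -/
lemma exists_isOpenEmbedding [T2Space M₁] (D : ConnectedSumData n N M₁ M₂) :
    ∃ j : {z : M₁ // z ≠ D.φ₁ 0} → N, IsOpenEmbedding j ∧
      ∀ (x : D.C₁) (h : (D.h₁ x : M₁) ≠ D.φ₁ 0), j ⟨D.h₁ x, h⟩ = x := by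
  classical
  let a : ((D.φ₁ '' Metric.ball 0 1)ᶜ : Set M₁) → {z : M₁ // z ≠ D.φ₁ 0} := fun z =>
    ⟨z, fun h => z.2 ⟨0, by simp, h.symm⟩⟩
  let b : {x : EuclideanSpace ℝ (Fin n) // x ≠ 0 ∧ ‖x‖ ≤ 1} → {z : M₁ // z ≠ D.φ₁ 0} :=
    fun x => ⟨D.φ₁ x, fun h => x.2.1 (D.emb₁.injective h)⟩
  let β : {x : EuclideanSpace ℝ (Fin n) // x ≠ 0 ∧ ‖x‖ ≤ 1} → N := fun x =>
    D.symm.collar (twistedInversionHomeomorph D.gluing x)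
  have hβ : IsEmbedding β :=
    D.symm.isEmbedding_collar.comp (twistedInversionHomeomorph D.gluing).isEmbedding
  have hb : IsEmbedding b :=
    (D.emb₁.isEmbedding.comp IsEmbedding.subtypeVal).codRestrict {z | z ≠ D.φ₁ 0} _
  have mem_a : ∀ z, z ∈ Set.range a ↔ z.1 ∉ D.φ₁ '' Metric.ball 0 1 := fun z =>
    ⟨by rintro ⟨w, rfl⟩; exact w.2, fun h => ⟨⟨z, h⟩, rfl⟩⟩
  have mem_b : ∀ z, z ∈ Set.range b ↔ z.1 ∈ D.φ₁ '' Metric.closedBall 0 1 := by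
    refine fun z => ⟨?_, ?_⟩
    · rintro ⟨w, rfl⟩
      exact ⟨w, by simpa using w.2.2, rfl⟩
    · rintro ⟨x, hx, hxz⟩
      exact ⟨⟨x, by rintro rfl; exact z.2 hxz.symm, by simpa using hx⟩, Subtype.ext hxz⟩
  have hab : ∀ z, z ∈ Set.range a ∨ z ∈ Set.range b := fun z => by
    rw [mem_a, mem_b, or_iff_not_imp_left, not_not]
    exact fun h => Set.image_mono Metric.ball_subset_closedBall h
  have hac : IsClosedEmbedding a := by
    refine ⟨IsEmbedding.subtypeVal.codRestrict {z | z ≠ D.φ₁ 0} _, ?_⟩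
    have : Set.range a = Subtype.val ⁻¹' (D.φ₁ '' Metric.ball 0 1)ᶜ := Set.ext mem_a
    rw [this]
    exact (D.emb₁.isOpenMap _ Metric.isOpen_ball).isClosed_compl.preimage continuous_subtype_val
  have hbc : IsClosedEmbedding b := by
    refine ⟨hb, ?_⟩
    have : Set.range b = Subtype.val ⁻¹' (D.φ₁ '' Metric.closedBall 0 1) := Set.ext mem_b
    rw [this]
    exact ((isCompact_closedBall _ _).image D.emb₁.continuous).isClosed.preimage
      continuous_subtype_val
  let j : {z : M₁ // z ≠ D.φ₁ 0} → N := fun z =>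
    if h : z.1 ∉ D.φ₁ '' Metric.ball 0 1 then D.h₁.symm ⟨z, h⟩
    else β ((hab z).resolve_left (by rwa [mem_a])).choose
  have hja : ∀ z, j (a z) = D.h₁.symm z := fun z => dif_pos z.2
  have hjb : ∀ x, j (b x) = β x := by
    intro x
    by_cases h : (b x).1 ∉ D.φ₁ '' Metric.ball 0 1
    · have hx : ‖(x : EuclideanSpace ℝ (Fin n))‖ = 1 := by
        refine le_antisymm x.2.2 (le_of_not_gt fun hlt => h ⟨x, by simpa using hlt, rfl⟩)
      have h₁ := D.boundary_gluing ⟨x, by simpa using hx⟩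
      have h₂ : β x = D.symm.boundary (D.gluing ⟨x, by simpa using hx⟩) := by
        refine congrArg D.symm.collar (Subtype.ext ?_)
        exact twistedInversion_of_norm_eq_one D.gluing ⟨x, by simpa using hx⟩ x.2.1
      rw [h₂, h₁]
      exact dif_pos h
    · simp only [j, h, dif_neg, not_false_eq_true]
      congr 1
      exact hb.injective (Exists.choose_spec (p := fun y => b y = b x) _)
  have hjC₁ : ∀ z, j z ∈ D.C₁ ↔ z ∈ Set.range a := by
    refine fun z => ⟨fun h => ?_, ?_⟩
    · rcases hab z with hz | ⟨w, rfl⟩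
      · exact hz
      · rw [hjb] at h
        have h₁ := (D.symm.collar_mem_iff _).1 h
        have h₂ : ‖(w : EuclideanSpace ℝ (Fin n))‖⁻¹ = 1 :=
          (norm_twistedInversionHomeomorph D.gluing w).symm.trans h₁
        rw [mem_a]
        exact D.φ₁_notMem (inv_eq_one.1 h₂).ge
    · rintro ⟨w, rfl⟩
      rw [hja]
      exact Subtype.coe_prop _
  have hjC₂ : ∀ z, j z ∈ D.C₂ ↔ z ∈ Set.range b := by
    refine fun z => ⟨fun h => ?_, ?_⟩
    · rcases hab z with ⟨w, rfl⟩ | hz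
      · rw [hja] at h
        rw [mem_b]
        have := (D.inter₁ _).1 h
        rw [D.h₁.apply_symm_apply] at this
        exact Set.image_mono Metric.sphere_subset_closedBall this
      · exact hz
    · rintro ⟨w, rfl⟩
      rw [hjb]
      exact D.symm.collar_mem _
  have hj : IsEmbedding j := by
    refine isEmbedding_of_closed_cover hac hbc hab ?_ ?_ D.closed₁ D.closed₂ hjC₁ hjC₂
    · rw [show j ∘ a = Subtype.val ∘ D.h₁.symm from funext hja]
      exact IsEmbedding.subtypeVal.comp D.h₁.symm.isEmbedding
    · rwa [show j ∘ b = β from funext hjb]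
  have hja' : ∀ (x : D.C₁) (h : (D.h₁ x : M₁) ≠ D.φ₁ 0), j ⟨D.h₁ x, h⟩ = x := fun x h => by
    refine (hja (D.h₁ x)).trans ?_
    rw [D.h₁.symm_apply_apply]
  refine ⟨j, ⟨hj, ?_⟩, hja'⟩
  have hcompl : (Set.range j)ᶜ =
      (Subtype.val : D.C₂ → N) '' ((fun x => (D.h₂ x : M₂)) ⁻¹' (Set.range D.φ₂)ᶜ) := by
    ext x
    constructor
    · intro hx
      have hx₁ : x ∉ D.C₁ := fun h => hx ⟨a (D.h₁ ⟨x, h⟩), by rw [hja]; simp⟩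
      have hx₂ : x ∈ D.C₂ := (D.mem_or_mem x).resolve_left hx₁
      refine ⟨⟨x, hx₂⟩, ?_, rfl⟩
      rintro ⟨y, hy⟩
      obtain ⟨hy', rfl⟩ := D.symm.exists_collar_eq hx₂ hy.symm
      refine hx ⟨b ((twistedInversionHomeomorph D.gluing).symm ⟨y, hy'⟩), ?_⟩
      rw [hjb]
      simp [β]
    · rintro ⟨x, hx, rfl⟩ ⟨z, hz⟩
      obtain ⟨y, rfl⟩ := (hjC₂ z).1 (hz ▸ x.2)
      rw [hjb] at hz
      refine hx ⟨_, (D.symm.h₁_collar (twistedInversionHomeomorph D.gluing y)).symm.trans ?_⟩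
      exact congrArg (fun w => (D.h₂ w : M₂)) (Subtype.ext hz)
  rw [← isClosed_compl_iff, hcompl]
  exact D.closed₂.isClosedEmbedding_subtypeVal.isClosedMap _
    (D.emb₂.isOpen_range.isClosed_compl.preimage (continuous_subtype_val.comp D.h₂.continuous))

end ConnectedSumData

/-- Any point of `P` lies in the second member of some two-element open cover of `P` by sets
deformable to a point. -/
def HasNullPair (P : Type*) [TopologicalSpace P] : Prop :=
  ∀ e : P, ∃ V W : Set P, IsOpen V ∧ IsOpen W ∧ IsNullIn V ∧ IsNullIn W ∧
    (∀ z, z ∈ V ∨ z ∈ W) ∧ e ∈ W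

namespace ConnectedSumData

variable {n : ℕ} {N M₁ M₂ : Type} [TopologicalSpace N] [TopologicalSpace M₁]
  [TopologicalSpace M₂]

lemma compactSpace [CompactSpace M₁] [CompactSpace M₂] (D : ConnectedSumData n N M₁ M₂) :
    CompactSpace N := by
  have h₁ : CompactSpace ((D.φ₁ '' Metric.ball 0 1)ᶜ : Set M₁) := isCompact_iff_compactSpace.1
    (D.emb₁.isOpenMap _ Metric.isOpen_ball).isClosed_compl.isCompact
  have h₂ : CompactSpace ((D.φ₂ '' Metric.ball 0 1)ᶜ : Set M₂) := isCompact_iff_compactSpace.1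
    (D.emb₂.isOpenMap _ Metric.isOpen_ball).isClosed_compl.isCompact
  refine ⟨?_⟩
  rw [← D.cover]
  exact (isCompact_iff_compactSpace.2 D.h₁.symm.compactSpace).union
    (isCompact_iff_compactSpace.2 D.h₂.symm.compactSpace)

lemma isClosed_diagonal_piece [T2Space M₁] (D : ConnectedSumData n N M₁ M₂) :
    IsClosed ((fun x : N => (x, x)) '' D.C₁) := by
  have h₁ : T2Space D.C₁ := D.h₁.symm.t2Space
  have hval := D.closed₁.isClosedEmbedding_subtypeVal
  have := (hval.prodMap hval).isClosedMap _ isClosed_diagonal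
  convert this using 1
  ext ⟨x, y⟩
  constructor
  · rintro ⟨z, hz, h⟩
    exact ⟨(⟨z, hz⟩, ⟨z, hz⟩), rfl, h⟩
  · rintro ⟨⟨z, w⟩, hzw, h⟩
    obtain rfl : z = w := hzw
    exact ⟨z, z.2, h⟩

lemma t2Space [T2Space M₁] [T2Space M₂] (D : ConnectedSumData n N M₁ M₂) : T2Space N := by
  rw [t2_iff_isClosed_diagonal]
  convert D.isClosed_diagonal_piece.union D.symm.isClosed_diagonal_piece using 1
  rw [← Set.image_union, show D.C₁ ∪ D.symm.C₁ = Set.univ from D.cover, Set.image_univ]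
  ext ⟨x, y⟩
  simp

lemma h₁_ne (D : ConnectedSumData n N M₁ M₂) (x : D.C₁) : (D.h₁ x : M₁) ≠ D.φ₁ 0 :=
  fun h => (D.h₁ x).2 ⟨0, by simp, h.symm⟩

/-- The complement of a ray from the origin is an open set deformable to a point; its image covers
the gluing sphere up to one point. -/
lemma exists_isNullIn_boundary [PathConnectedSpace N] [T2Space M₁]
    (D : ConnectedSumData n N M₁ M₂)
    (s₀ : Metric.sphere (0 : EuclideanSpace ℝ (Fin n)) 1) :
    ∃ U : Set N, IsOpen U ∧ IsNullIn U ∧ ∀ x ∈ D.C₁ ∩ D.C₂, x ≠ D.boundary s₀ → x ∈ U := by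
  obtain ⟨j, hj, hjx⟩ := D.exists_isOpenEmbedding
  let S : Set (EuclideanSpace ℝ (Fin n)) := {x | x ≠ ‖x‖ • (s₀ : EuclideanSpace ℝ (Fin n))}
  have hs₀ : ‖(s₀ : EuclideanSpace ℝ (Fin n))‖ = 1 := by simp
  have hs₀' : (s₀ : EuclideanSpace ℝ (Fin n)) ≠ 0 := norm_ne_zero_iff.1 (by simp)
  have key : ∀ (x : EuclideanSpace ℝ (Fin n)) (c : ℝ), 0 ≤ c → x ∈ S →
      x ≠ c • (s₀ : EuclideanSpace ℝ (Fin n)) := by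
    rintro x c hc hx rfl
    apply hx
    rw [norm_smul, hs₀, mul_one, Real.norm_of_nonneg hc]
  have hSo : IsOpen S := isOpen_ne_fun continuous_id (continuous_norm.smul continuous_const)
  have hmem : -(s₀ : EuclideanSpace ℝ (Fin n)) ∈ S := by
    intro h
    rw [norm_neg, hs₀, one_smul] at h
    exact ne_neg_of_mem_unit_sphere ℝ s₀ (Subtype.ext h.symm)
  have hstar : StarConvex ℝ (-(s₀ : EuclideanSpace ℝ (Fin n))) S := by
    intro x hx a b ha hb hab h
    set c := ‖a • -(s₀ : EuclideanSpace ℝ (Fin n)) + b • x‖ with hc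
    have hc0 : 0 ≤ c := norm_nonneg _
    have h' : b • x = (c + a) • (s₀ : EuclideanSpace ℝ (Fin n)) := by
      rw [add_smul, ← h]
      simp
    rcases hb.eq_or_lt with rfl | hb
    · rw [zero_smul, eq_comm, smul_eq_zero] at h'
      rcases h' with h' | h'
      · linarith
      · exact hs₀' h'
    · refine key x (b⁻¹ * (c + a)) (by positivity) hx ?_
      rw [mul_smul, ← h', inv_smul_smul₀ hb.ne']
  have := hstar.contractibleSpace ⟨_, hmem⟩
  have hS0 : ∀ x : S, D.φ₁ x ≠ D.φ₁ 0 := fun x h => by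
    have h0 := x.2
    rw [D.emb₁.injective h] at h0
    simp [S] at h0
  let f : S → {z : M₁ // z ≠ D.φ₁ 0} := fun x => ⟨D.φ₁ x, hS0 x⟩
  have hf : IsOpenEmbedding f :=
    IsOpenEmbedding.of_comp f (isOpen_compl_singleton (x := D.φ₁ 0)).isOpenEmbedding_subtypeVal
      (D.emb₁.comp hSo.isOpenEmbedding_subtypeVal)
  refine ⟨Set.range (j ∘ f), (hj.comp hf).isOpen_range, isNullIn_range (hj.comp hf).isEmbedding,
    fun x hx hxq => ?_⟩
  rw [← D.range_boundary] at hx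
  obtain ⟨u, rfl⟩ := hx
  refine ⟨⟨u, fun h => hxq ?_⟩, ?_⟩
  · rw [norm_eq_of_mem_sphere, one_smul] at h
    rw [Subtype.ext h]
  · have h := hjx ⟨_, D.collar_mem ⟨u, by simp⟩⟩ (D.h₁_ne _)
    refine Eq.trans ?_ h
    exact congrArg j (Subtype.ext (D.h₁_collar ⟨u, by simp⟩).symm)

/-- A connected sum of two compact spaces whose punctured versions are each covered by two open sets
deformable to a point is covered by three such sets, hence admits five motion planners. -/
lemma tcCoverable [T2Space M₁] [T2Space M₂] [CompactSpace M₁] [CompactSpace M₂] [NeZero n]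
    (D : ConnectedSumData n N M₁ M₂)
    (hp₁ : PathConnectedSpace {z : M₁ // z ≠ D.φ₁ 0})
    (hp₂ : PathConnectedSpace {z : M₂ // z ≠ D.φ₂ 0})
    (hc₁ : HasNullPair {z : M₁ // z ≠ D.φ₁ 0}) (hc₂ : HasNullPair {z : M₂ // z ≠ D.φ₂ 0}) :
    TCCoverable N 5 := by
  have := D.compactSpace
  have := D.t2Space
  obtain ⟨j₁, hj₁, hjx₁⟩ := D.exists_isOpenEmbedding
  obtain ⟨j₂, hj₂, hjx₂⟩ := D.symm.exists_isOpenEmbedding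
  let s₀ : Metric.sphere (0 : EuclideanSpace ℝ (Fin n)) 1 := ⟨EuclideanSpace.single 0 1, by simp⟩
  set q := D.boundary s₀
  have hqC : q ∈ D.C₁ ∩ D.C₂ := D.range_boundary ▸ Set.mem_range_self s₀
  have hr₁ : ∀ x ∈ D.C₁, ∃ z, j₁ z = x := fun x hx => ⟨_, hjx₁ ⟨x, hx⟩ (D.h₁_ne _)⟩
  have hr₂ : ∀ x ∈ D.C₂, ∃ z, j₂ z = x := fun x hx => ⟨_, hjx₂ ⟨x, hx⟩ (D.symm.h₁_ne _)⟩
  obtain ⟨e₁, he₁⟩ := hr₁ q hqC.1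
  obtain ⟨e₂, he₂⟩ := hr₂ q hqC.2
  have : PathConnectedSpace {z : M₂ // z ≠ D.symm.φ₁ 0} := hp₂
  have : PathConnectedSpace N := by
    rw [pathConnectedSpace_iff_univ]
    convert (isPathConnected_range hj₁.continuous).union (isPathConnected_range hj₂.continuous)
      ⟨q, ⟨e₁, he₁⟩, ⟨e₂, he₂⟩⟩
    exact (Set.eq_univ_of_forall fun x => (D.mem_or_mem x).imp (hr₁ x) (hr₂ x)).symm
  have : Nonempty {z : M₂ // z ≠ D.symm.φ₁ 0} := ⟨e₂⟩
  obtain ⟨V₁, W₁, hV₁, hW₁, hV₁', hW₁', hcov₁, heW₁⟩ := hc₁ e₁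
  obtain ⟨V₂, W₂, hV₂, hW₂, hV₂', hW₂', hcov₂, heW₂⟩ := hc₂ e₂
  obtain ⟨B, hB, hB', hBq⟩ := D.exists_isNullIn_boundary s₀
  have hqW : j₁ '' W₁ ∩ j₂ '' W₂ ∈ 𝓝 q :=
    ((hj₁.isOpenMap _ hW₁).inter (hj₂.isOpenMap _ hW₂)).mem_nhds
      ⟨⟨e₁, heW₁, he₁⟩, ⟨e₂, heW₂, he₂⟩⟩
  obtain ⟨K, ⟨hKq, hK⟩, hKW⟩ := (closed_nhds_basis q).mem_iff.1 hqW
  obtain ⟨O, hOK, hO, hqO⟩ := mem_nhds_iff.1 hKq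
  have hC₁ : IsOpen D.C₁ᶜ := D.closed₁.isOpen_compl
  have hC₂ : IsOpen D.C₂ᶜ := D.closed₂.isOpen_compl
  have hC : Disjoint D.C₂ᶜ D.C₁ᶜ := by
    rw [Set.disjoint_left]
    intro x h₂ h₁
    exact (D.mem_or_mem x).elim h₁ h₂
  let A : Set N := ((j₁ '' V₁ ∩ D.C₂ᶜ) ∪ (j₂ '' V₂ ∩ D.C₁ᶜ)) ∩ Kᶜ ∪ O
  let A' : Set N := (j₁ '' W₁ ∩ D.C₂ᶜ) ∪ (j₂ '' W₂ ∩ D.C₁ᶜ)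
  have oV₁ : IsOpen (j₁ '' V₁ ∩ D.C₂ᶜ) := (hj₁.isOpenMap _ hV₁).inter hC₂
  have oV₂ : IsOpen (j₂ '' V₂ ∩ D.C₁ᶜ) := (hj₂.isOpenMap _ hV₂).inter hC₁
  have oW₁ : IsOpen (j₁ '' W₁ ∩ D.C₂ᶜ) := (hj₁.isOpenMap _ hW₁).inter hC₂
  have oW₂ : IsOpen (j₂ '' W₂ ∩ D.C₁ᶜ) := (hj₂.isOpenMap _ hW₂).inter hC₁
  have nV : IsNullIn ((j₁ '' V₁ ∩ D.C₂ᶜ) ∪ (j₂ '' V₂ ∩ D.C₁ᶜ)) :=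
    .union oV₁ oV₂ (hC.mono Set.inter_subset_right Set.inter_subset_right)
      ((hV₁'.image hj₁.isEmbedding).mono Set.inter_subset_left)
      ((hV₂'.image hj₂.isEmbedding).mono Set.inter_subset_left)
  have nA : IsNullIn A := by
    refine .union ((oV₁.union oV₂).inter hK.isOpen_compl) hO ?_ (nV.mono Set.inter_subset_left)
      ((hW₁'.image hj₁.isEmbedding).mono fun x hx => (hKW (hOK hx)).1)
    rw [Set.disjoint_left]
    exact fun x hx hxO => hx.2 (hOK hxO)
  have nA' : IsNullIn A' :=
    .union oW₁ oW₂ (hC.mono Set.inter_subset_right Set.inter_subset_right)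
      ((hW₁'.image hj₁.isEmbedding).mono Set.inter_subset_left)
      ((hW₂'.image hj₂.isEmbedding).mono Set.inter_subset_left)
  refine tcCoverable_of_isNullIn (m := 2) (U := ![A, A', B]) ?_ ?_ ?_
  · intro i
    fin_cases i
    · exact ((oV₁.union oV₂).inter hK.isOpen_compl).union hO
    · exact oW₁.union oW₂
    · exact hB
  · refine Set.eq_univ_of_forall fun x => ?_
    suffices x ∈ A ∨ x ∈ A' ∨ x ∈ B by simpa [Fin.exists_fin_succ] using this
    by_cases h₂ : x ∈ D.C₂
    · by_cases h₁ : x ∈ D.C₁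
      · by_cases hxq : x = q
        · exact .inl (.inr (hxq ▸ hqO))
        · exact .inr (.inr (hBq x ⟨h₁, h₂⟩ hxq))
      · obtain ⟨z, rfl⟩ := hr₂ x h₂
        rcases hcov₂ z with hz | hz
        · by_cases hxK : j₂ z ∈ K
          · exact .inr (.inl (.inr ⟨(hKW hxK).2, h₁⟩))
          · exact .inl (.inl ⟨.inr ⟨⟨z, hz, rfl⟩, h₁⟩, hxK⟩)
        · exact .inr (.inl (.inr ⟨⟨z, hz, rfl⟩, h₁⟩))
    · obtain ⟨z, rfl⟩ := hr₁ x ((D.mem_or_mem x).resolve_right h₂)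
      rcases hcov₁ z with hz | hz
      · by_cases hxK : j₁ z ∈ K
        · exact .inr (.inl (.inl ⟨(hKW hxK).1, h₂⟩))
        · exact .inl (.inl ⟨.inl ⟨⟨z, hz, rfl⟩, h₂⟩, hxK⟩)
      · exact .inr (.inl (.inl ⟨⟨z, hz, rfl⟩, h₂⟩))
  · intro i
    fin_cases i
    · exact nA
    · exact nA'
    · exact hB'

end ConnectedSumData

/-! ### Punctured products of spheres -/

section PuncturedSpheres

variable {n : ℕ}

lemma pathConnectedSpace_unitSphere (hn : 1 ≤ n) : PathConnectedSpace (unitSphere n) := by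
  rw [← isPathConnected_iff_pathConnectedSpace]
  refine isPathConnected_sphere ?_ 0 zero_le_one
  rw [rank_eq_card_basis (EuclideanSpace.basisFun (Fin (n + 1)) ℝ).toBasis]
  simp only [Fintype.card_fin]
  exact_mod_cast Nat.lt_succ_of_le hn

lemma ne_neg_unitSphere (x : unitSphere n) : x ≠ -x := fun h =>
  ne_neg_of_mem_unit_sphere ℝ x h

lemma pathConnectedSpace_punctured (hn : 1 ≤ n) (p : unitSphere n × unitSphere n) :
    PathConnectedSpace {z : unitSphere n × unitSphere n // z ≠ p} := by
  have := pathConnectedSpace_unitSphere hn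
  obtain ⟨a, b⟩ := p
  let P := {z : unitSphere n × unitSphere n // z ≠ (a, b)}
  have hv : ∀ x (hx : x ≠ a) (y y' : unitSphere n),
      Joined (⟨(x, y), fun h => hx (congrArg Prod.fst h)⟩ : P)
        ⟨(x, y'), fun h => hx (congrArg Prod.fst h)⟩ := fun x hx y y' =>
    ⟨(PathConnectedSpace.somePath y y').map
      (f := fun w => (⟨(x, w), fun h => hx (congrArg Prod.fst h)⟩ : P)) (by fun_prop)⟩
  have hh : ∀ y (hy : y ≠ b) (x x' : unitSphere n),
      Joined (⟨(x, y), fun h => hy (congrArg Prod.snd h)⟩ : P)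
        ⟨(x', y), fun h => hy (congrArg Prod.snd h)⟩ := fun y hy x x' =>
    ⟨(PathConnectedSpace.somePath x x').map
      (f := fun w => (⟨(w, y), fun h => hy (congrArg Prod.snd h)⟩ : P)) (by fun_prop)⟩
  have ha := (ne_neg_unitSphere a).symm
  have hb := (ne_neg_unitSphere b).symm
  let c : P := ⟨(-a, -b), fun h => ha (congrArg Prod.fst h)⟩
  have hc : ∀ z : P, Joined z c := by
    rintro ⟨⟨x, y⟩, hz⟩
    by_cases hx : x = a
    · have hy : y ≠ b := fun hy => hz (by rw [hx, hy])
      exact (hh y hy x (-a)).trans (hv _ ha y (-b))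
    · exact (hv x hx y (-b)).trans (hh _ hb x (-a))
  exact ⟨⟨c⟩, fun z w => (hc z).trans (hc w).symm⟩

lemma exists_isEmbedding_range_eq_compl (v : unitSphere n) :
    ∃ f : EuclideanSpace ℝ (Fin n) → unitSphere n, IsEmbedding f ∧ Set.range f = {v}ᶜ := by
  have : Fact (Module.finrank ℝ (EuclideanSpace ℝ (Fin (n + 1))) = n + 1) := ⟨by simp⟩
  let e := (stereographic' n v).symm
  have he : e.source = Set.univ := stereographic'_target v
  refine ⟨e, (e.isOpenEmbedding he).isEmbedding, ?_⟩
  rw [← Set.image_univ, ← he, e.image_source_eq_target]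
  exact stereographic'_source v

lemma isNullIn_compl_prod_compl (hn : 1 ≤ n) {p : unitSphere n × unitSphere n}
    {a b : unitSphere n} (h : a = p.1 ∨ b = p.2) :
    IsNullIn {z : {z : unitSphere n × unitSphere n // z ≠ p} | z.1.1 ≠ a ∧ z.1.2 ≠ b} := by
  have := pathConnectedSpace_punctured hn p
  obtain ⟨f, hf, hfr⟩ := exists_isEmbedding_range_eq_compl a
  obtain ⟨g, hg, hgr⟩ := exists_isEmbedding_range_eq_compl b
  have hfa : ∀ u, f u ≠ a := fun u => hfr.subset (Set.mem_range_self u)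
  have hgb : ∀ u, g u ≠ b := fun u => hgr.subset (Set.mem_range_self u)
  have hne : ∀ u, Prod.map f g u ≠ p := by
    rintro u rfl
    exact h.elim (fun h => hfa _ h.symm) (fun h => hgb _ h.symm)
  have : ContractibleSpace (EuclideanSpace ℝ (Fin n) × EuclideanSpace ℝ (Fin n)) :=
    RealTopologicalVectorSpace.contractibleSpace
  refine (isNullIn_range (X := {z : unitSphere n × unitSphere n // z ≠ p})
    ((hf.prodMap hg).codRestrict {z | z ≠ p} hne)).mono ?_
  rintro ⟨⟨x, y⟩, hz⟩ ⟨hx, hy⟩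
  obtain ⟨u, rfl⟩ := hfr.superset hx
  obtain ⟨w, rfl⟩ := hgr.superset hy
  exact ⟨(u, w), rfl⟩

lemma ne_neg_of_dist_lt {x a y b : unitSphere n} (h : dist x a < dist y b) : x ≠ -a := by
  rintro rfl
  have h₁ : dist (-a) a = 2 := by
    rw [Subtype.dist_eq, dist_eq_norm]
    have : ((-a : unitSphere n) : EuclideanSpace ℝ (Fin (n + 1))) - a = (-2 : ℝ) • a.1 := by
      rw [neg_smul, two_smul]
      simp [sub_eq_add_neg]
    rw [this, norm_smul]
    simp
  have h₂ : dist y b ≤ 2 := by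
    rw [Subtype.dist_eq, dist_eq_norm]
    refine (norm_sub_le _ _).trans ?_
    simp only [norm_eq_of_mem_sphere]
    norm_num
  linarith

lemma hasNullPair_punctured (hn : 1 ≤ n) (p : unitSphere n × unitSphere n) :
    HasNullPair {z : unitSphere n × unitSphere n // z ≠ p} := by
  let P := {z : unitSphere n × unitSphere n // z ≠ p}
  have c₁ : Continuous fun z : P => z.1.1 := continuous_fst.comp continuous_subtype_val
  have c₂ : Continuous fun z : P => z.1.2 := continuous_snd.comp continuous_subtype_val
  let V : Set P := {z | z.1.1 ≠ p.1 ∧ z.1.2 ≠ p.2}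
  let W₁ : Set P := {z | dist z.1.1 p.1 < dist z.1.2 p.2}
  let W₂ : Set P := {z | dist z.1.2 p.2 < dist z.1.1 p.1}
  have hV : IsOpen V := (isOpen_ne_fun c₁ continuous_const).inter (isOpen_ne_fun c₂ continuous_const)
  have d₁ : Continuous fun z : P => dist z.1.1 p.1 := c₁.dist continuous_const
  have d₂ : Continuous fun z : P => dist z.1.2 p.2 := c₂.dist continuous_const
  have hW₁ : IsOpen W₁ := isOpen_lt d₁ d₂
  have hW₂ : IsOpen W₂ := isOpen_lt d₂ d₁
  have nV : IsNullIn V := isNullIn_compl_prod_compl hn (.inl rfl)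
  have nW : IsNullIn (W₁ ∪ W₂) := by
    refine .union hW₁ hW₂ (Set.disjoint_left.2 fun z h h' =>
      lt_asymm (show dist z.1.1 p.1 < dist z.1.2 p.2 from h) h') ?_ ?_
    · refine (isNullIn_compl_prod_compl hn (a := -p.1) (b := p.2) (.inr rfl)).mono fun z hz => ?_
      exact ⟨ne_neg_of_dist_lt hz, dist_pos.1 (dist_nonneg.trans_lt hz)⟩
    · refine (isNullIn_compl_prod_compl hn (a := p.1) (b := -p.2) (.inl rfl)).mono fun z hz => ?_
      exact ⟨dist_pos.1 (dist_nonneg.trans_lt hz), ne_neg_of_dist_lt hz⟩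
  have hcov : ∀ z, z ∈ V ∨ z ∈ W₁ ∪ W₂ := by
    intro z
    by_cases h₁ : z.1.1 = p.1
    · have h₂ : z.1.2 ≠ p.2 := fun h₂ => z.2 (Prod.ext h₁ h₂)
      refine .inr (.inl ?_)
      simpa [W₁, h₁] using h₂
    · by_cases h₂ : z.1.2 = p.2
      · refine .inr (.inr ?_)
        simpa [W₂, h₂] using h₁
      · exact .inl ⟨h₁, h₂⟩
  intro e
  rcases hcov e with he | he
  · exact ⟨W₁ ∪ W₂, V, hW₁.union hW₂, hV, nW, nV, fun z => (hcov z).symm, he⟩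
  · exact ⟨V, W₁ ∪ W₂, hV, hW₁.union hW₂, nV, nW, hcov, he⟩

end PuncturedSpheres

/-- **Example.**  For every `n ≥ 2`, `TC((Sⁿ × Sⁿ) # (Sⁿ × Sⁿ)) ≤ 5`. -/
theorem tc_connectedSum_sphere_products_le
    (n : ℕ) (hn : 2 ≤ n) (N : Type) [TopologicalSpace N]
    (hN : IsConnectedSum (2 * n) N (unitSphere n × unitSphere n)
      (unitSphere n × unitSphere n)) :
    topologicalComplexity N ≤ 5 := by
  obtain ⟨D⟩ := hN
  have : NeZero (2 * n) := ⟨by omega⟩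
  have hn1 : 1 ≤ n := by omega
  have h : TCCoverable N 5 :=
    D.tcCoverable (pathConnectedSpace_punctured hn1 _) (pathConnectedSpace_punctured hn1 _)
      (hasNullPair_punctured hn1 _) (hasNullPair_punctured hn1 _)
  exact sInf_le ⟨5, rfl, h⟩

end
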